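/- Let α, β ∈ ℝ and η = ±1. For the Lie algebra 𝔤₄ with its canonical connection ∇^c, the symmetrized Ricci tensor ρ̃^c of ∇^c is a Codazzi tensor for ∇^c if and only if α/2 + η − β = 0. -/

import Mathlib

noncomputable section

/-- The underlying vector space `V = ℝ³`. -/
abbrev V : Type := Fin 3 → ℝ

/-- The basis vector e₁. -/
def e1 : V := ![1, 0, 0]
/-- The basis vector e₂. -/
def e2 : V := ![0, 1, 0]
/-- The basis vector e₃. -/
def e3 : V := ![0, 0, 1]

/-- The Lorentzian inner product with g(e₁,e₁)=g(e₂,e₂)=1, g(e₃,e₃)=−1. -/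
def gL (x y : V) : ℝ := x 0 * y 0 + x 1 * y 1 - x 2 * y 2

/-- Curvature R(X,Y)Z = ∇_X ∇_Y Z − ∇_Y ∇_X Z − ∇_{[X,Y]} Z. -/
def curv (nabla bracket : V → V → V) (x y z : V) : V :=
  nabla x (nabla y z) - nabla y (nabla x z) - nabla (bracket x y) z

/-- Ricci tensor ρ(X,Y) = −g(R(X,e₁)Y,e₁) − g(R(X,e₂)Y,e₂) + g(R(X,e₃)Y,e₃). -/
def ricci (nabla bracket : V → V → V) (x y : V) : ℝ :=
  - gL (curv nabla bracket x e1 y) e1 - gL (curv nabla bracket x e2 y) e2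
  + gL (curv nabla bracket x e3 y) e3

/-- Symmetrized Ricci tensor ρ̃(X,Y) = (ρ(X,Y) + ρ(Y,X))/2. -/
def ricciSym (nabla bracket : V → V → V) (x y : V) : ℝ :=
  (ricci nabla bracket x y + ricci nabla bracket y x) / 2

/-- Covariant derivative of a (left-invariant) bilinear form:
(∇_X ω)(Y,Z) = −ω(∇_X Y, Z) − ω(Y, ∇_X Z). -/
def covDer (nabla : V → V → V) (ω : V → V → ℝ) (x y z : V) : ℝ :=
  - ω (nabla x y) z - ω y (nabla x z)

/-- ω is a Codazzi tensor for ∇: (∇_X ω)(Y,Z) = (∇_Y ω)(X,Z) for all X,Y,Z. -/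
def IsCodazzi (nabla : V → V → V) (ω : V → V → ℝ) : Prop :=
  ∀ x y z : V, covDer nabla ω x y z = covDer nabla ω y x z

/-- Torsion T(X,Y) = ∇_X Y − ∇_Y X − [X,Y]. -/
def torsion (nabla bracket : V → V → V) (x y : V) : V :=
  nabla x y - nabla y x - bracket x y

/-- (V,∇,ω) is a quasi-statistical structure:
(∇_X ω)(Y,Z) − (∇_Y ω)(X,Z) + ω(T(X,Y),Z) = 0 for all X,Y,Z. -/
def IsQuasiStatistical (nabla bracket : V → V → V) (ω : V → V → ℝ) : Prop :=
  ∀ x y z : V,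
    covDer nabla ω x y z - covDer nabla ω y x z + ω (torsion nabla bracket x y) z = 0

/-- The Lie bracket of the Lie algebra 𝔤4. -/
def bracket (α β η : ℝ) (x y : V) : V :=
  ![ (x 1 * y 2 - x 2 * y 1) * (α),
     (x 0 * y 1 - x 1 * y 0) * (-1) + (x 0 * y 2 - x 2 * y 0) * (-β),
     (x 0 * y 1 - x 1 * y 0) * (2*η-β) + (x 0 * y 2 - x 2 * y 0) * (1) ]

/-- The canonical connection ∇^c of 𝔤4. -/
def nabla (α β η : ℝ) (x y : V) : V :=
  ![ x 1 * y 1 * (-1) + x 2 * y 1 * (-(α/2+η)),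
     x 1 * y 0 * (1) + x 2 * y 0 * (α/2+η),
     (0:ℝ) ]

/-- The symmetrized Ricci tensor of the canonical connection of 𝔤4 in coordinates. -/
theorem ricciSym_nabla (α β η : ℝ) (x y : V) :
    ricciSym (nabla α β η) (bracket α β η) x y =
      ((α / 2 + η) * (2 * η - β) - 1) * (x 0 * y 0 + x 1 * y 1)
        + (α / 2 + η - β) / 2 * (x 2 * y 1 + x 1 * y 2) := by
  simp [ricciSym, ricci, curv, gL, nabla, bracket, e1, e2, e3]
  ring

/-- The covariant derivative of the symmetrized Ricci tensor of the canonical connection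
of 𝔤4 in coordinates. -/
theorem covDer_ricciSym_nabla (α β η : ℝ) (x y z : V) :
    covDer (nabla α β η) (ricciSym (nabla α β η) (bracket α β η)) x y z =
      -((α / 2 + η - β) / 2) * (x 1 + x 2 * (α / 2 + η)) * (y 0 * z 2 + y 2 * z 0) := by
  simp only [covDer, ricciSym_nabla]
  simp [nabla]
  ring

theorem stmt15 (α β η : ℝ) (hη : η = 1 ∨ η = -1) :
    IsCodazzi (nabla α β η) (ricciSym (nabla α β η) (bracket α β η)) ↔ α / 2 + η - β = 0 := by
  constructor
  · intro h
    have h₁ := h e2 e1 e3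
    simp only [covDer_ricciSym_nabla] at h₁
    simp [e1, e2, e3] at h₁
    linarith
  · intro h x y z
    simp [covDer_ricciSym_nabla, h]

end
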